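/- Cauchy–Schwarz bound for squared resolvents: for every E ∈ ℝ and τ > 0, writing z = E + iτ, for all N×N complex matrices P, Q and all vectors x, y ∈ ℂ^N, one has |⟨x, P G(z)² Q y⟩| ≤ τ^{−1} · ⟨x, P Im G(z) P* x⟩^{1/2} · ⟨y, Q* Im G(z) Q y⟩^{1/2}. -/

import Mathlib

open Matrix

/-- The resolvent `G(z) = (W - z·Id)⁻¹` of a matrix `W`. -/
noncomputable def resolv {N : ℕ} (W : Matrix (Fin N) (Fin N) ℂ) (z : ℂ) :
    Matrix (Fin N) (Fin N) ℂ :=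
  (W - z • (1 : Matrix (Fin N) (Fin N) ℂ))⁻¹

/-- The "imaginary part" `Im G(z) = (G(z) - G(z)*)/(2i)` of the resolvent. -/
noncomputable def imRes {N : ℕ} (W : Matrix (Fin N) (Fin N) ℂ) (z : ℂ) :
    Matrix (Fin N) (Fin N) ℂ :=
  (2 * Complex.I)⁻¹ • (resolv W z - (resolv W z)ᴴ)

/-- Cauchy–Schwarz for the dot product on `ℂ^N`. -/
lemma norm_star_dotProduct_le {ι : Type*} [Fintype ι] (u v : ι → ℂ) :
    ‖star u ⬝ᵥ v‖ ≤ √(star u ⬝ᵥ u).re * √(star v ⬝ᵥ v).re := by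
  have key (a b : ι → ℂ) : star a ⬝ᵥ b = inner ℂ (WithLp.toLp 2 a) (WithLp.toLp 2 b) := by
    rw [EuclideanSpace.inner_toLp_toLp, dotProduct_comm]
  have hself (a : ι → ℂ) : √(star a ⬝ᵥ a).re = ‖WithLp.toLp 2 a‖ := by
    rw [key, norm_eq_sqrt_re_inner (𝕜 := ℂ)]
    rfl
  rw [hself, hself, key]
  exact norm_inner_le_norm _ _

open scoped ComplexOrder in
/-- `W - z` is invertible for Hermitian `W` and `Im z > 0`. -/
lemma isUnit_det_sub_smul_one {N : ℕ} {W : Matrix (Fin N) (Fin N) ℂ} (hW : W.IsHermitian)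
    (E : ℝ) {τ : ℝ} (hτ : 0 < τ) :
    IsUnit (W - ((E : ℂ) + (τ : ℂ) * Complex.I) • (1 : Matrix (Fin N) (Fin N) ℂ)).det := by
  set A := W - ((E : ℂ) + (τ : ℂ) * Complex.I) • (1 : Matrix (Fin N) (Fin N) ℂ) with hA
  set B := W - (E : ℂ) • (1 : Matrix (Fin N) (Fin N) ℂ) with hB
  have hBH : Bᴴ = B := by simp [hB, hW.eq]
  have hAB : A = B - ((τ : ℂ) * Complex.I) • 1 := by rw [hA, hB, add_smul]; abel
  have hmul : Aᴴ * A = Bᴴ * B + ((τ : ℂ) ^ 2) • 1 := by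
    rw [hAB]
    simp only [conjTranspose_sub, conjTranspose_smul, conjTranspose_one, hBH, sub_mul, mul_sub, smul_sub,
      smul_mul_assoc, mul_smul_comm, one_mul, mul_one, smul_smul, star_mul', RCLike.star_def,
      Complex.conj_ofReal, Complex.conj_I]
    rw [show (τ : ℂ) * Complex.I * (τ * -Complex.I) = (τ : ℂ) ^ 2 by
      linear_combination -(τ : ℂ) ^ 2 * Complex.I_sq]
    module
  have hpos : (Aᴴ * A).PosDef := by
    rw [hmul]
    refine PosDef.posSemidef_add (posSemidef_conjTranspose_mul_self B) (PosDef.one.smul ?_)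
    exact_mod_cast pow_pos hτ 2
  have := (isUnit_iff_isUnit_det _).mp hpos.isUnit
  rw [det_mul] at this
  exact isUnit_of_mul_isUnit_right this

/-- The Ward identities `Im G = τ G G* = τ G* G`. -/
lemma imRes_eq_smul_mul {N : ℕ} {W : Matrix (Fin N) (Fin N) ℂ} (hW : W.IsHermitian)
    (E : ℝ) {τ : ℝ} (hτ : 0 < τ) :
    imRes W (E + τ * Complex.I) =
        (τ : ℂ) • (resolv W (E + τ * Complex.I) * (resolv W (E + τ * Complex.I))ᴴ) ∧
      imRes W (E + τ * Complex.I) =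
        (τ : ℂ) • ((resolv W (E + τ * Complex.I))ᴴ * resolv W (E + τ * Complex.I)) := by
  have hu := isUnit_det_sub_smul_one hW E hτ
  unfold imRes resolv
  set A := W - ((E : ℂ) + (τ : ℂ) * Complex.I) • (1 : Matrix (Fin N) (Fin N) ℂ) with hA
  have h₁ : A⁻¹ * A = 1 := nonsing_inv_mul _ hu
  have h₂ : A * A⁻¹ = 1 := mul_nonsing_inv _ hu
  have h₃ : (A⁻¹)ᴴ * Aᴴ = 1 := by rw [← conjTranspose_mul, h₂, conjTranspose_one]
  have h₄ : Aᴴ * (A⁻¹)ᴴ = 1 := by rw [← conjTranspose_mul, h₁, conjTranspose_one]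
  have hd : Aᴴ - A = (2 * Complex.I * τ) • (1 : Matrix (Fin N) (Fin N) ℂ) := by
    simp only [hA, conjTranspose_sub, conjTranspose_smul, conjTranspose_one, hW.eq, star_add,
      star_mul', RCLike.star_def, Complex.conj_ofReal, Complex.conj_I]
    module
  have e₁ : A⁻¹ - (A⁻¹)ᴴ = A⁻¹ * (Aᴴ - A) * (A⁻¹)ᴴ := by
    rw [mul_sub, sub_mul, mul_assoc, h₄, h₁, mul_one, one_mul]
  have e₂ : A⁻¹ - (A⁻¹)ᴴ = (A⁻¹)ᴴ * (Aᴴ - A) * A⁻¹ := by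
    rw [mul_sub, sub_mul, h₃, mul_assoc, h₂, mul_one, one_mul]
  have hc : (2 * Complex.I)⁻¹ * (2 * Complex.I * τ) = (τ : ℂ) :=
    inv_mul_cancel_left₀ (by simp) _
  constructor
  · rw [e₁, hd, mul_smul_comm, mul_one, smul_mul_assoc, smul_smul, hc]
  · rw [e₂, hd, mul_smul_comm, mul_one, smul_mul_assoc, smul_smul, hc]

/-- Cauchy–Schwarz bound for squared resolvents:
`|⟨x, P G(z)² Q y⟩| ≤ τ⁻¹ ⟨x, P Im G(z) P* x⟩^{1/2} ⟨y, Q* Im G(z) Q y⟩^{1/2}` for `z = E+iτ`. -/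
theorem squared_resolvent_cs_bound {N : ℕ} (hN : 1 ≤ N) (W : Matrix (Fin N) (Fin N) ℂ)
    (hW : W.IsHermitian) (E τ : ℝ) (hτ : 0 < τ)
    (P Q : Matrix (Fin N) (Fin N) ℂ) (x y : Fin N → ℂ) :
    ‖(star x ⬝ᵥ (P * resolv W ((E : ℂ) + (τ : ℂ) * Complex.I) ^ 2 * Q).mulVec y)‖ ≤
      τ⁻¹ *
        Real.sqrt ((star x ⬝ᵥ (P * imRes W ((E : ℂ) + (τ : ℂ) * Complex.I) * Pᴴ).mulVec x).re) *
        Real.sqrt ((star y ⬝ᵥ (Qᴴ * imRes W ((E : ℂ) + (τ : ℂ) * Complex.I) * Q).mulVec y).re) := by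
  obtain ⟨hr, hl⟩ := imRes_eq_smul_mul hW E hτ
  set G := resolv W ((E : ℂ) + (τ : ℂ) * Complex.I)
  have hx : (star x ⬝ᵥ (P * imRes W ((E : ℂ) + (τ : ℂ) * Complex.I) * Pᴴ).mulVec x).re =
      τ * (star ((P * G)ᴴ *ᵥ x) ⬝ᵥ ((P * G)ᴴ *ᵥ x)).re := by
    rw [hr, star_mulVec, conjTranspose_conjTranspose, ← dotProduct_mulVec, mulVec_mulVec,
      conjTranspose_mul, mul_smul_comm, smul_mul_assoc, smul_mulVec, dotProduct_smul, smul_eq_mul,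
      Complex.re_ofReal_mul]
    simp only [mul_assoc]
  have hy : (star y ⬝ᵥ (Qᴴ * imRes W ((E : ℂ) + (τ : ℂ) * Complex.I) * Q).mulVec y).re =
      τ * (star ((G * Q) *ᵥ y) ⬝ᵥ ((G * Q) *ᵥ y)).re := by
    rw [hl, star_mulVec, ← dotProduct_mulVec, mulVec_mulVec,
      conjTranspose_mul, mul_smul_comm, smul_mul_assoc, smul_mulVec, dotProduct_smul, smul_eq_mul,
      Complex.re_ofReal_mul]
    simp only [mul_assoc]
  have hxy : star x ⬝ᵥ (P * G ^ 2 * Q).mulVec y =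
      star ((P * G)ᴴ *ᵥ x) ⬝ᵥ ((G * Q) *ᵥ y) := by
    rw [star_mulVec, conjTranspose_conjTranspose, ← dotProduct_mulVec, mulVec_mulVec]
    simp only [pow_two, mul_assoc]
  rw [hx, hy, hxy, Real.sqrt_mul hτ.le, Real.sqrt_mul hτ.le]
  refine (norm_star_dotProduct_le _ _).trans_eq ?_
  have hs : τ⁻¹ * (√τ * √τ) = 1 := by rw [Real.mul_self_sqrt hτ.le, inv_mul_cancel₀ hτ.ne']
  linear_combination
    -(√(star ((P * G)ᴴ *ᵥ x) ⬝ᵥ ((P * G)ᴴ *ᵥ x)).re *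
      √(star ((G * Q) *ᵥ y) ⬝ᵥ ((G * Q) *ᵥ y)).re) * hs
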